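/- Let d ≥ 3, let n ≥ 1, and let X be uniformly distributed on the Euclidean ball of radius √(n+2) centered at the origin in ℝⁿ. Then for every homogeneous polynomial f of degree d on ℝⁿ, Var(f(X)) ≥ coeff_d(f)² / (d+1)!. -/

import Mathlib

open MeasureTheory

/-- The `d`-level content of a multivariate polynomial. -/
noncomputable def coeffd {n : ℕ} (d : ℕ) (f : MvPolynomial (Fin n) ℝ) : ℝ :=
  Real.sqrt (∑ m ∈ f.support.filter (fun m => (∑ i, m i) = d), f.coeff m ^ 2)

/-- The uniform (normalized Lebesgue) probability measure on a set `s ⊆ ℝⁿ`. -/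
noncomputable def unif {n : ℕ} (s : Set (Fin n → ℝ)) : Measure (Fin n → ℝ) :=
  (volume s)⁻¹ • volume.restrict s

/-- The isotropic Euclidean ball: radius `√(n+2)`, centered at the origin of `ℝⁿ`. -/
def isoBall (n : ℕ) : Set (Fin n → ℝ) :=
  {x | ∑ i, (x i) ^ 2 ≤ (n : ℝ) + 2}

/-- The integral of a real polynomial against the weight `exp (-x² / 2)`. -/
noncomputable def gaussPoly (p : Polynomial ℝ) : ℝ :=
  ∫ x : ℝ, p.eval x * Real.exp (-(x ^ 2) / 2)

theorem integrable_eval_mul_exp (p : Polynomial ℝ) :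
    Integrable fun x : ℝ => p.eval x * Real.exp (-(x ^ 2) / 2) := by
  induction p using Polynomial.induction_on' with
  | add p q hp hq => simpa only [Polynomial.eval_add, add_mul] using hp.fun_add hq
  | monomial k a =>
    have h := (integrable_rpow_mul_exp_neg_mul_sq (b := 1 / 2) (by norm_num)
      (s := (k : ℝ)) (by linarith [k.cast_nonneg (α := ℝ)])).const_mul a
    refine h.congr (Filter.Eventually.of_forall fun x => ?_)
    simp only [Real.rpow_natCast, Polynomial.eval_monomial]
    rw [show -(x ^ 2) / 2 = -(1 / 2) * x ^ 2 by ring]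
    ring

theorem gaussPoly_add (p q : Polynomial ℝ) : gaussPoly (p + q) = gaussPoly p + gaussPoly q := by
  unfold gaussPoly
  rw [← integral_add (integrable_eval_mul_exp p) (integrable_eval_mul_exp q)]
  simp [add_mul]

theorem gaussPoly_sub (p q : Polynomial ℝ) : gaussPoly (p - q) = gaussPoly p - gaussPoly q := by
  unfold gaussPoly
  rw [← integral_sub (integrable_eval_mul_exp p) (integrable_eval_mul_exp q)]
  simp [sub_mul]

theorem gaussPoly_C (a : ℝ) : gaussPoly (Polynomial.C a) = a * gaussPoly 1 := by
  unfold gaussPoly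
  rw [← integral_const_mul]
  simp

theorem gaussPoly_one_pos : 0 < gaussPoly 1 := by
  have h : gaussPoly 1 = ∫ x : ℝ, Real.exp (-(1 / 2) * x ^ 2) := by
    unfold gaussPoly
    congr 1
    ext x
    rw [Polynomial.eval_one, one_mul]
    congr 1
    ring
  rw [h, integral_gaussian]
  positivity

/-- Integration by parts against the Gaussian weight. -/
theorem gaussPoly_X_mul (p : Polynomial ℝ) :
    gaussPoly (Polynomial.X * p) = gaussPoly (Polynomial.derivative p) := by
  have h : ∫ x : ℝ, (Polynomial.derivative p - Polynomial.X * p).eval x *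
      Real.exp (-(x ^ 2) / 2) = 0 := by
    refine integral_eq_zero_of_hasDerivAt_of_integrable
      (f := fun x => p.eval x * Real.exp (-(x ^ 2) / 2)) (fun x => ?_)
      (integrable_eval_mul_exp _) (integrable_eval_mul_exp _)
    have h1 : HasDerivAt (fun x : ℝ => -(x ^ 2) / 2) (-x) x := by
      refine (((hasDerivAt_pow 2 x).fun_neg).div_const 2).congr_deriv ?_
      push_cast
      ring
    refine ((p.hasDerivAt x).fun_mul h1.exp).congr_deriv ?_
    simp only [Polynomial.eval_sub, Polynomial.eval_mul, Polynomial.eval_X]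
    ring
  have h2 := gaussPoly_sub (Polynomial.derivative p) (Polynomial.X * p)
  rw [gaussPoly, h] at h2
  linarith

/-- The probabilists' Hermite polynomials with real coefficients. -/
noncomputable def hermiteReal (k : ℕ) : Polynomial ℝ :=
  (Polynomial.hermite k).map (Int.castRingHom ℝ)

theorem hermiteReal_succ (k : ℕ) : hermiteReal (k + 1) =
    Polynomial.X * hermiteReal k - Polynomial.derivative (hermiteReal k) := by
  simp [hermiteReal, Polynomial.hermite_succ, Polynomial.derivative_map]

theorem hermiteReal_monic (k : ℕ) : (hermiteReal k).Monic :=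
  (Polynomial.hermite_monic k).map _

theorem natDegree_hermiteReal (k : ℕ) : (hermiteReal k).natDegree = k := by
  rw [hermiteReal, (Polynomial.hermite_monic k).natDegree_map, Polynomial.natDegree_hermite]

theorem gaussPoly_mul_hermiteReal (k : ℕ) (p : Polynomial ℝ) :
    gaussPoly (p * hermiteReal k) = gaussPoly (Polynomial.derivative^[k] p) := by
  induction k generalizing p with
  | zero => simp [hermiteReal]
  | succ k ih =>
    rw [Function.iterate_succ_apply, ← ih, hermiteReal_succ, mul_sub, gaussPoly_sub,
      mul_left_comm, gaussPoly_X_mul, Polynomial.derivative_mul, gaussPoly_add]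
    ring

theorem gaussPoly_mul_hermiteReal_of_lt {k : ℕ} {p : Polynomial ℝ} (h : p.natDegree < k) :
    gaussPoly (p * hermiteReal k) = 0 := by
  rw [gaussPoly_mul_hermiteReal, Polynomial.iterate_derivative_eq_zero h]
  simp [gaussPoly]

theorem gaussPoly_mul_hermiteReal_of_monic {k : ℕ} {p : Polynomial ℝ} (hp : p.Monic)
    (h : p.natDegree = k) :
    gaussPoly (p * hermiteReal k) = k.factorial * gaussPoly 1 := by
  subst h
  rw [gaussPoly_mul_hermiteReal, ← gaussPoly_C]
  congr 1
  rw [Polynomial.eq_C_of_natDegree_le_zero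
    ((Polynomial.natDegree_iterate_derivative p p.natDegree).trans (Nat.sub_self _).le),
    Polynomial.coeff_iterate_derivative]
  simp [hp.coeff_natDegree, Nat.descFactorial_self]

theorem prod_eval_mul_exp {n : ℕ} (p : Fin n → Polynomial ℝ) (x : Fin n → ℝ) :
    (∏ i, (p i).eval (x i)) * Real.exp (-(∑ i, x i ^ 2) / 2) =
      ∏ i, ((p i).eval (x i) * Real.exp (-(x i ^ 2) / 2)) := by
  rw [Finset.prod_mul_distrib, ← Real.exp_sum, ← Finset.sum_div, Finset.sum_neg_distrib]

theorem integrable_prod_eval_mul_exp {n : ℕ} (p : Fin n → Polynomial ℝ) :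
    Integrable fun x : Fin n → ℝ =>
      (∏ i, (p i).eval (x i)) * Real.exp (-(∑ i, x i ^ 2) / 2) := by
  simp only [prod_eval_mul_exp]
  exact Integrable.fintype_prod (f := fun i t => (p i).eval t * Real.exp (-(t ^ 2) / 2))
    fun i => integrable_eval_mul_exp (p i)

theorem integral_prod_eval_mul_exp {n : ℕ} (p : Fin n → Polynomial ℝ) :
    ∫ x : Fin n → ℝ, (∏ i, (p i).eval (x i)) * Real.exp (-(∑ i, x i ^ 2) / 2) =
      ∏ i, gaussPoly (p i) := by
  simp only [prod_eval_mul_exp]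
  exact integral_fintype_prod_volume_eq_prod
    (fun i t => (p i).eval t * Real.exp (-(t ^ 2) / 2))

theorem integral_exp_neg_normSq (n : ℕ) :
    ∫ x : Fin n → ℝ, Real.exp (-(∑ i, x i ^ 2) / 2) = gaussPoly 1 ^ n := by
  simpa using integral_prod_eval_mul_exp (n := n) fun _ => 1

theorem sum_mul_sum_mul_exp {n : ℕ} {ι : Type*} (S : Finset ι) (a : ι → ℝ)
    (P Q : ι → Fin n → Polynomial ℝ) (x : Fin n → ℝ) :
    (∑ I ∈ S, a I * ∏ i, (P I i).eval (x i)) * (∑ J ∈ S, a J * ∏ i, (Q J i).eval (x i)) *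
        Real.exp (-(∑ i, x i ^ 2) / 2) =
      ∑ I ∈ S, ∑ J ∈ S, a I * a J * ((∏ i, (P I i * Q J i).eval (x i)) *
        Real.exp (-(∑ i, x i ^ 2) / 2)) := by
  rw [Finset.sum_mul_sum, Finset.sum_mul]
  refine Finset.sum_congr rfl fun I _ => ?_
  rw [Finset.sum_mul]
  refine Finset.sum_congr rfl fun J _ => ?_
  simp only [Polynomial.eval_mul, Finset.prod_mul_distrib]
  ring

theorem integrable_sum_mul_sum_mul_exp {n : ℕ} {ι : Type*} (S : Finset ι) (a : ι → ℝ)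
    (P Q : ι → Fin n → Polynomial ℝ) :
    Integrable fun x : Fin n → ℝ => (∑ I ∈ S, a I * ∏ i, (P I i).eval (x i)) *
      (∑ J ∈ S, a J * ∏ i, (Q J i).eval (x i)) * Real.exp (-(∑ i, x i ^ 2) / 2) := by
  simp only [sum_mul_sum_mul_exp]
  exact integrable_finsetSum _ fun I _ => integrable_finsetSum _ fun J _ =>
    (integrable_prod_eval_mul_exp _).const_mul _

theorem integral_sum_mul_sum_mul_exp {n : ℕ} {ι : Type*} (S : Finset ι) (a : ι → ℝ)
    (P Q : ι → Fin n → Polynomial ℝ) :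
    ∫ x : Fin n → ℝ, (∑ I ∈ S, a I * ∏ i, (P I i).eval (x i)) *
      (∑ J ∈ S, a J * ∏ i, (Q J i).eval (x i)) * Real.exp (-(∑ i, x i ^ 2) / 2) =
      ∑ I ∈ S, ∑ J ∈ S, a I * a J * ∏ i, gaussPoly (P I i * Q J i) := by
  simp only [sum_mul_sum_mul_exp]
  rw [integral_finsetSum _ fun I _ => integrable_finsetSum _ fun J _ =>
    (integrable_prod_eval_mul_exp _).const_mul _]
  refine Finset.sum_congr rfl fun I _ => ?_
  rw [integral_finsetSum _ fun J _ => (integrable_prod_eval_mul_exp _).const_mul _]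
  refine Finset.sum_congr rfl fun J _ => ?_
  rw [integral_const_mul, integral_prod_eval_mul_exp]

/-- Products of monic polynomials of a given total degree pair diagonally with products of Hermite
polynomials of the same total degree. -/
theorem integral_monic_mul_hermite {n d : ℕ} {S : Finset (Fin n →₀ ℕ)}
    (hS : ∀ I ∈ S, ∑ i, I i = d) (a : (Fin n →₀ ℕ) → ℝ) (P : ℕ → Polynomial ℝ)
    (hP : ∀ k, (P k).Monic) (hPd : ∀ k, (P k).natDegree = k) :
    ∫ x : Fin n → ℝ, (∑ I ∈ S, a I * ∏ i, (P (I i)).eval (x i)) *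
      (∑ J ∈ S, a J * ∏ i, (hermiteReal (J i)).eval (x i)) *
        Real.exp (-(∑ i, x i ^ 2) / 2) =
      (∑ I ∈ S, a I ^ 2 * ∏ i, ((I i).factorial : ℝ)) * gaussPoly 1 ^ n := by
  rw [integral_sum_mul_sum_mul_exp S a (fun I i => P (I i)) (fun J i => hermiteReal (J i)),
    Finset.sum_mul]
  refine Finset.sum_congr rfl fun I hI => ?_
  rw [Finset.sum_eq_single_of_mem I hI]
  · simp only [gaussPoly_mul_hermiteReal_of_monic (hP _) (hPd _), Finset.prod_mul_distrib,
      Finset.prod_const, Finset.card_univ, Fintype.card_fin]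
    ring
  · intro J hJ hJI
    obtain ⟨i, hi⟩ : ∃ i, I i < J i := by
      by_contra! h
      have h1 := (Finset.sum_eq_sum_iff_of_le (s := Finset.univ) fun i _ => h i).1
        ((hS J hJ).trans (hS I hI).symm)
      exact hJI (Finsupp.ext fun i => h1 i (Finset.mem_univ i))
    rw [Finset.prod_eq_zero (Finset.mem_univ i), mul_zero]
    exact gaussPoly_mul_hermiteReal_of_lt (by rwa [hPd])

theorem sum_eq_of_mem_support {n d : ℕ} {f : MvPolynomial (Fin n) ℝ} (hf : f.IsHomogeneous d)
    {I : Fin n →₀ ℕ} (hI : I ∈ f.support) : ∑ i, I i = d := by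
  rw [← hf (MvPolynomial.mem_support_iff.1 hI), Finsupp.weight_apply,
    Finsupp.sum_fintype _ _ (by simp)]
  simp

/-- The Gaussian second moment of a homogeneous polynomial dominates its squared content. -/
theorem sum_coeff_sq_mul_le_integral_exp {n d : ℕ} {f : MvPolynomial (Fin n) ℝ}
    (hf : f.IsHomogeneous d) :
    (∑ m ∈ f.support, f.coeff m ^ 2) * gaussPoly 1 ^ n ≤
      ∫ x : Fin n → ℝ, MvPolynomial.eval x f ^ 2 * Real.exp (-(∑ i, x i ^ 2) / 2) := by
  have hS : ∀ I ∈ f.support, ∑ i, I i = d := fun I hI => sum_eq_of_mem_support hf hI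
  set w : (Fin n → ℝ) → ℝ := fun x => Real.exp (-(∑ i, x i ^ 2) / 2) with hw
  set h : (Fin n → ℝ) → ℝ :=
    fun x => ∑ J ∈ f.support, f.coeff J * ∏ i, (hermiteReal (J i)).eval (x i) with hh
  have hfe : ∀ x, MvPolynomial.eval x f =
      ∑ I ∈ f.support, f.coeff I * ∏ i, ((Polynomial.X ^ I i : Polynomial ℝ)).eval (x i) := by
    intro x
    rw [MvPolynomial.eval_eq']
    simp
  have iff' : Integrable fun x => MvPolynomial.eval x f * MvPolynomial.eval x f * w x := by
    simp only [hfe]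
    exact integrable_sum_mul_sum_mul_exp f.support f.coeff (fun I i => Polynomial.X ^ I i)
      (fun I i => Polynomial.X ^ I i)
  have ifh : Integrable fun x => MvPolynomial.eval x f * h x * w x := by
    simp only [hfe]
    exact integrable_sum_mul_sum_mul_exp f.support f.coeff (fun I i => Polynomial.X ^ I i)
      (fun I i => hermiteReal (I i))
  have ihh : Integrable fun x => h x * h x * w x :=
    integrable_sum_mul_sum_mul_exp f.support f.coeff (fun I i => hermiteReal (I i))
      (fun I i => hermiteReal (I i))
  have efh : ∫ x, MvPolynomial.eval x f * h x * w x =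
      (∑ I ∈ f.support, f.coeff I ^ 2 * ∏ i, ((I i).factorial : ℝ)) * gaussPoly 1 ^ n := by
    simp only [hfe]
    exact integral_monic_mul_hermite hS f.coeff (fun k => Polynomial.X ^ k)
      Polynomial.monic_X_pow Polynomial.natDegree_X_pow
  have ehh : ∫ x, h x * h x * w x =
      (∑ I ∈ f.support, f.coeff I ^ 2 * ∏ i, ((I i).factorial : ℝ)) * gaussPoly 1 ^ n :=
    integral_monic_mul_hermite hS f.coeff hermiteReal hermiteReal_monic natDegree_hermiteReal
  have hle : ∫ x, (2 * (MvPolynomial.eval x f * h x * w x) - h x * h x * w x) ≤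
      ∫ x, MvPolynomial.eval x f * MvPolynomial.eval x f * w x := by
    refine integral_mono ((ifh.const_mul 2).sub ihh) iff' fun x => ?_
    have hwx : 0 ≤ w x := (Real.exp_pos _).le
    have := mul_nonneg (sq_nonneg (MvPolynomial.eval x f - h x)) hwx
    simp only
    linarith
  rw [integral_sub (ifh.const_mul 2) ihh, integral_const_mul, efh, ehh] at hle
  have hcoef : ∑ m ∈ f.support, f.coeff m ^ 2 ≤
      ∑ I ∈ f.support, f.coeff I ^ 2 * ∏ i, ((I i).factorial : ℝ) := by
    refine Finset.sum_le_sum fun I _ => le_mul_of_one_le_right (sq_nonneg _) ?_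
    exact_mod_cast Nat.one_le_iff_ne_zero.2
      (Finset.prod_ne_zero_iff.2 fun i _ => (I i).factorial_ne_zero)
  have := mul_le_mul_of_nonneg_right hcoef (pow_nonneg gaussPoly_one_pos.le n)
  simp only [pow_two (MvPolynomial.eval _ f)]
  linarith

open scoped Pointwise

/-- The closed Euclidean ball of squared radius `s` in `ℝⁿ`. -/
def sqBall (n : ℕ) (s : ℝ) : Set (Fin n → ℝ) :=
  {x | ∑ i, x i ^ 2 ≤ s}

theorem isClosed_sqBall (n : ℕ) (s : ℝ) : IsClosed (sqBall n s) :=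
  isClosed_le (by fun_prop) continuous_const

theorem isCompact_sqBall (n : ℕ) (s : ℝ) : IsCompact (sqBall n s) := by
  refine Metric.isCompact_of_isClosed_isBounded (isClosed_sqBall n s) ?_
  refine (Metric.isBounded_closedBall (x := 0) (r := √s)).subset fun x hx => ?_
  rw [mem_closedBall_zero_iff, pi_norm_le_iff_of_nonneg (Real.sqrt_nonneg s)]
  intro i
  rw [Real.norm_eq_abs]
  refine Real.abs_le_sqrt (le_trans ?_ hx)
  exact Finset.single_le_sum (f := fun i => x i ^ 2) (fun j _ => sq_nonneg _) (Finset.mem_univ i)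

theorem volume_sqBall_pos (n : ℕ) {s : ℝ} (hs : 0 < s) : 0 < volume (sqBall n s) := by
  have ho : IsOpen {x : Fin n → ℝ | ∑ i, x i ^ 2 < s} :=
    isOpen_lt (by fun_prop) continuous_const
  refine (ho.measure_pos volume ⟨0, by simpa using hs⟩).trans_le (measure_mono fun x hx => ?_)
  exact le_of_lt (show ∑ i, x i ^ 2 < s from hx)

theorem integrableOn_sqBall {n : ℕ} {q : (Fin n → ℝ) → ℝ} (hq : Continuous q) (s : ℝ) :
    IntegrableOn q (sqBall n s) :=
  hq.continuousOn.integrableOn_compact (isCompact_sqBall n s)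

theorem smul_sqBall_one (n : ℕ) {r : ℝ} (hr : 0 < r) : r • sqBall n 1 = sqBall n (r ^ 2) := by
  ext x
  rw [Set.mem_smul_set_iff_inv_smul_mem₀ hr.ne']
  simp only [sqBall, Set.mem_ofPred_eq, Pi.smul_apply, smul_eq_mul, mul_pow, ← Finset.mul_sum,
    inv_pow]
  rw [inv_mul_le_iff₀ (by positivity), mul_one]

/-- Scaling of ball integrals of homogeneous functions. -/
theorem setIntegral_sqBall_of_homogeneous {n k : ℕ} {q : (Fin n → ℝ) → ℝ}
    (hq : ∀ r : ℝ, 0 < r → ∀ x, q (r • x) = r ^ k * q x) {r : ℝ} (hr : 0 < r) :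
    ∫ x in sqBall n (r ^ 2), q x = r ^ (n + k) * ∫ x in sqBall n 1, q x := by
  have h := Measure.setIntegral_comp_smul_of_pos volume q (sqBall n 1) hr
  rw [smul_sqBall_one n hr] at h
  simp only [hq r hr, integral_const_mul, Module.finrank_fin_fun, smul_eq_mul] at h
  rw [pow_add, mul_assoc, h, mul_inv_cancel_left₀ (by positivity)]

/-- Layer-cake formula for radial weights against a homogeneous function. -/
theorem integral_mul_radial {n k : ℕ} {q : (Fin n → ℝ) → ℝ} (hqc : Continuous q)
    (hq : ∀ r : ℝ, 0 < r → ∀ x, q (r • x) = r ^ k * q x) {w : ℝ → ℝ} (hwm : Measurable w)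
    (hw0 : ∀ r ∈ Set.Ioi (0 : ℝ), 0 ≤ w r)
    (hwi : IntegrableOn (fun r => w r * r ^ (n + k)) (Set.Ioi 0)) :
    ∫ x, q x * (∫ r in Set.Ioi (0 : ℝ), if ∑ i, x i ^ 2 ≤ r ^ 2 then w r else 0) =
      (∫ r in Set.Ioi (0 : ℝ), w r * r ^ (n + k)) * ∫ x in sqBall n 1, q x := by
  have hF : ∀ r : ℝ, (fun x => q x * if ∑ i, x i ^ 2 ≤ r ^ 2 then w r else 0) =
      (sqBall n (r ^ 2)).indicator fun x => w r * q x := by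
    intro r
    ext x
    by_cases h : ∑ i, x i ^ 2 ≤ r ^ 2
    · simp [sqBall, h, mul_comm]
    · simp [sqBall, h]
  have hms : ∀ s, MeasurableSet (sqBall n s) := fun s => (isClosed_sqBall n s).measurableSet
  have hint : Integrable (Function.uncurry fun (x : Fin n → ℝ) (r : ℝ) =>
      q x * if ∑ i, x i ^ 2 ≤ r ^ 2 then w r else 0)
      (volume.prod (volume.restrict (Set.Ioi 0))) := by
    have hmeas : Measurable (Function.uncurry fun (x : Fin n → ℝ) (r : ℝ) =>
        q x * if ∑ i, x i ^ 2 ≤ r ^ 2 then w r else 0) := by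
      refine (hqc.measurable.comp measurable_fst).mul (Measurable.ite ?_
        (hwm.comp measurable_snd) measurable_const)
      exact measurableSet_le (by fun_prop) (by fun_prop)
    rw [integrable_prod_iff' hmeas.aestronglyMeasurable]
    constructor
    · refine Filter.Eventually.of_forall fun r => ?_
      simp only [Function.uncurry_apply_pair, hF]
      exact IntegrableOn.integrable_indicator
        ((integrableOn_sqBall hqc (r ^ 2)).const_mul (w r)) (hms _)
    · have hnorm : ∀ r ∈ Set.Ioi (0 : ℝ), ∫ x, ‖q x * if ∑ i, x i ^ 2 ≤ r ^ 2 then w r else 0‖ =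
          (∫ x in sqBall n 1, |q x|) * (w r * r ^ (n + k)) := by
        intro r hr
        have h1 : (fun x => ‖q x * if ∑ i, x i ^ 2 ≤ r ^ 2 then w r else 0‖) =
            (sqBall n (r ^ 2)).indicator fun x => w r * |q x| := by
          ext x
          rw [congrFun (hF r) x, norm_indicator_eq_indicator_norm]
          simp only [norm_mul, Real.norm_eq_abs, abs_of_nonneg (hw0 r hr)]
        rw [h1, integral_indicator (hms _), integral_const_mul]
        have h3 := setIntegral_sqBall_of_homogeneous (n := n) (q := fun x => |q x|)
          (fun r hr x => by rw [hq r hr, abs_mul, abs_of_pos (pow_pos hr k)]) hr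
        rw [h3]
        ring
      refine IntegrableOn.congr_fun (hwi.const_mul (∫ x in sqBall n 1, |q x|))
        (fun r hr => ?_) measurableSet_Ioi
      exact (hnorm r hr).symm
  calc _ = ∫ x, ∫ r in Set.Ioi (0 : ℝ), q x * if ∑ i, x i ^ 2 ≤ r ^ 2 then w r else 0 := by
        simp only [integral_const_mul]
    _ = ∫ r in Set.Ioi (0 : ℝ), ∫ x, q x * if ∑ i, x i ^ 2 ≤ r ^ 2 then w r else 0 :=
        integral_integral_swap hint
    _ = ∫ r in Set.Ioi (0 : ℝ), w r * r ^ (n + k) * ∫ x in sqBall n 1, q x := by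
        refine setIntegral_congr_fun measurableSet_Ioi fun r hr => ?_
        simp only [hF]
        rw [integral_indicator (hms _), integral_const_mul,
          setIntegral_sqBall_of_homogeneous hq hr, mul_assoc]
    _ = _ := integral_mul_const _ _

/-- The radial Gaussian moment `∫₀^∞ r ^ (k + 1) exp (-r² / 2) dr`. -/
noncomputable def radialMoment (k : ℕ) : ℝ :=
  ∫ r in Set.Ioi (0 : ℝ), r * Real.exp (-(r ^ 2) / 2) * r ^ k

theorem radialMoment_eq (k : ℕ) : radialMoment k =
    (1 / 2 : ℝ) ^ (-((k : ℝ) / 2 + 1)) * (1 / 2) * Real.Gamma ((k : ℝ) / 2 + 1) := by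
  have h := integral_rpow_mul_exp_neg_mul_rpow (p := 2) (q := (k : ℝ) + 1) (b := 1 / 2)
    (by norm_num) (by linarith [k.cast_nonneg (α := ℝ)]) (by norm_num)
  rw [show -((k : ℝ) + 1 + 1) / 2 = -((k : ℝ) / 2 + 1) by ring,
    show ((k : ℝ) + 1 + 1) / 2 = (k : ℝ) / 2 + 1 by ring] at h
  rw [radialMoment, ← h]
  refine setIntegral_congr_fun measurableSet_Ioi fun r hr => ?_
  have h1 : r ^ ((k : ℝ) + 1) = r ^ k * r := by
    rw [Real.rpow_add_one (ne_of_gt hr), Real.rpow_natCast]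
  have h2 : r ^ (2 : ℝ) = r ^ 2 := by exact_mod_cast Real.rpow_natCast r 2
  simp only [h1, h2]
  rw [show -(r ^ 2) / 2 = -(1 / 2) * r ^ 2 by ring]
  ring

theorem radialMoment_pos (k : ℕ) : 0 < radialMoment k := by
  rw [radialMoment_eq]
  have := Real.Gamma_pos_of_pos (s := (k : ℝ) / 2 + 1) (by positivity)
  positivity

theorem radialMoment_add_two (k : ℕ) : radialMoment (k + 2) = (k + 2) * radialMoment k := by
  rw [radialMoment_eq, radialMoment_eq]
  push_cast
  rw [show ((k : ℝ) + 2) / 2 + 1 = ((k : ℝ) / 2 + 1) + 1 by ring,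
    Real.Gamma_add_one (by positivity),
    show -(((k : ℝ) / 2 + 1) + 1) = -((k : ℝ) / 2 + 1) - 1 by ring,
    Real.rpow_sub_one (by norm_num)]
  ring

theorem radialMoment_add_two_mul (n d : ℕ) : radialMoment (n + 2 * d) =
    (∏ j ∈ Finset.range d, ((n : ℝ) + 2 * (j + 1))) * radialMoment n := by
  induction d with
  | zero => simp
  | succ d ih =>
    rw [show n + 2 * (d + 1) = (n + 2 * d) + 2 by ring, radialMoment_add_two, ih,
      Finset.prod_range_succ]
    push_cast
    ring

theorem integrableOn_radial (k : ℕ) :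
    IntegrableOn (fun r : ℝ => r * Real.exp (-(r ^ 2) / 2) * r ^ k) (Set.Ioi 0) := by
  have h := (integrable_eval_mul_exp (Polynomial.X ^ (k + 1))).integrableOn (s := Set.Ioi 0)
  refine h.congr_fun (fun r _ => ?_) measurableSet_Ioi
  simp only [Polynomial.eval_pow, Polynomial.eval_X]
  ring

theorem setIntegral_ite_le_sq (s : ℝ) (w : ℝ → ℝ) :
    ∫ r in Set.Ioi (0 : ℝ), (if s ≤ r ^ 2 then w r else 0) = ∫ r in Set.Ioi (√s), w r := by
  have h : ∀ r ∈ Set.Ioi (0 : ℝ), (if s ≤ r ^ 2 then w r else 0) =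
      (Set.Ici (√s)).indicator w r := by
    intro r hr
    simp only [Set.indicator, Set.mem_Ici, Real.sqrt_le_left (le_of_lt hr)]
  rw [setIntegral_congr_fun measurableSet_Ioi h, setIntegral_indicator measurableSet_Ici]
  refine setIntegral_congr_set ?_
  have h1 : (Set.Ioi (0 : ℝ) ∩ Set.Ici (√s) : Set ℝ) =ᵐ[volume]
      (Set.Ioi (0 : ℝ) ∩ Set.Ioi (√s) : Set ℝ) :=
    Filter.EventuallyEq.inter (ae_eq_refl _) Ioi_ae_eq_Ici.symm
  rwa [Set.Ioi_inter_Ioi, max_eq_right (Real.sqrt_nonneg s)] at h1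

theorem setIntegral_Ioi_mul_exp (a : ℝ) :
    ∫ r in Set.Ioi a, r * Real.exp (-(r ^ 2) / 2) = Real.exp (-(a ^ 2) / 2) := by
  have hint : IntegrableOn (fun r : ℝ => r * Real.exp (-(r ^ 2) / 2)) (Set.Ioi a) := by
    simpa using (integrable_eval_mul_exp Polynomial.X).integrableOn (s := Set.Ioi a)
  have hlim : Filter.Tendsto (fun r : ℝ => -Real.exp (-(r ^ 2) / 2)) Filter.atTop (nhds (-0)) := by
    refine (Real.tendsto_exp_atBot.comp ?_).neg
    refine Filter.Tendsto.atBot_div_const (by norm_num) ?_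
    exact Filter.tendsto_neg_atTop_atBot.comp (Filter.tendsto_pow_atTop (by norm_num))
  rw [integral_Ioi_of_hasDerivAt_of_tendsto' (fun r _ => ?_) hint hlim]
  · ring
  · refine ((((hasDerivAt_pow 2 r).fun_neg).div_const 2).exp).fun_neg.congr_deriv ?_
    push_cast
    ring

/-- The Gaussian integral of a homogeneous function in terms of its integral on the unit ball. -/
theorem integral_mul_exp_of_homogeneous {n k : ℕ} {q : (Fin n → ℝ) → ℝ} (hqc : Continuous q)
    (hq : ∀ r : ℝ, 0 < r → ∀ x, q (r • x) = r ^ k * q x) :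
    ∫ x, q x * Real.exp (-(∑ i, x i ^ 2) / 2) =
      radialMoment (n + k) * ∫ x in sqBall n 1, q x := by
  rw [radialMoment, ← integral_mul_radial hqc hq (w := fun r => r * Real.exp (-(r ^ 2) / 2))
    (by fun_prop) (fun r hr => mul_nonneg (le_of_lt hr) (Real.exp_pos _).le)
    (integrableOn_radial _)]
  refine integral_congr_ae (Filter.Eventually.of_forall fun x => ?_)
  have hx : 0 ≤ ∑ i, x i ^ 2 := Finset.sum_nonneg fun i _ => sq_nonneg _
  simp only
  rw [setIntegral_ite_le_sq, setIntegral_Ioi_mul_exp, Real.sq_sqrt hx]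

theorem setIntegral_Ioi_ite_pow {a : ℝ} (c : ℝ) (N : ℕ) :
    ∫ r in Set.Ioi a, (if r ≤ 1 then c * r ^ N else 0) =
      if a ≤ 1 then c * ((1 - a ^ (N + 1)) / (N + 1)) else 0 := by
  have h : (fun r : ℝ => if r ≤ 1 then c * r ^ N else 0) =
      (Set.Iic 1).indicator fun r => c * r ^ N := by
    ext r
    simp [Set.indicator]
  rw [h, setIntegral_indicator measurableSet_Iic, Set.Ioi_inter_Iic]
  split_ifs with ha
  · rw [← intervalIntegral.integral_of_le ha, intervalIntegral.integral_const_mul, integral_pow,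
      one_pow]
  · rw [Set.Ioc_eq_empty (by linarith), setIntegral_empty]

/-- Multiplying a homogeneous function by an even power of the norm multiplies its integral over
the unit ball by an explicit constant. -/
theorem setIntegral_sqBall_mul_normSq_pow {n k : ℕ} {q : (Fin n → ℝ) → ℝ} (hqc : Continuous q)
    (hq : ∀ r : ℝ, 0 < r → ∀ x, q (r • x) = r ^ k * q x) (j : ℕ) :
    ((n : ℝ) + k + 2 * (j + 1)) * ∫ x in sqBall n 1, q x * (∑ i, x i ^ 2) ^ (j + 1) =
      ((n : ℝ) + k) * ∫ x in sqBall n 1, q x := by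
  set w : ℝ → ℝ := fun r => if r ≤ 1 then (2 * (j + 1) : ℝ) * r ^ (2 * j + 1) else 0 with hw
  have hwr : ∀ r, w r * r ^ (n + k) =
      if r ≤ 1 then (2 * (j + 1) : ℝ) * r ^ (2 * j + 1 + (n + k)) else 0 := by
    intro r
    simp only [hw, ite_mul, zero_mul]
    congr 1
    ring
  have hwi : IntegrableOn (fun r => w r * r ^ (n + k)) (Set.Ioi 0) := by
    simp only [hwr]
    have h1 : IntegrableOn (fun r : ℝ => (2 * (j + 1) : ℝ) * r ^ (2 * j + 1 + (n + k)))
        (Set.Icc 0 1) := (by fun_prop : Continuous _).continuousOn.integrableOn_compact isCompact_Icc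
    have h2 : (fun r : ℝ => if r ≤ 1 then (2 * (j + 1) : ℝ) * r ^ (2 * j + 1 + (n + k)) else 0) =
      (Set.Iic 1).indicator fun r => (2 * (j + 1) : ℝ) * r ^ (2 * j + 1 + (n + k)) := by
      ext r
      simp [Set.indicator]
    rw [h2, IntegrableOn, integrable_indicator_iff measurableSet_Iic, IntegrableOn,
      Measure.restrict_restrict measurableSet_Iic]
    exact h1.mono_set fun r hr => ⟨le_of_lt hr.2, hr.1⟩
  have key := integral_mul_radial hqc hq (w := w)
    (Measurable.ite measurableSet_Iic (by fun_prop) measurable_const)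
    (fun r hr => by
      have : (0 : ℝ) < r := hr
      simp only [hw]
      split_ifs <;> positivity) hwi
  have hR : ∫ r in Set.Ioi (0 : ℝ), w r * r ^ (n + k) =
      2 * (j + 1) / ((n : ℝ) + k + 2 * (j + 1)) := by
    simp only [hwr]
    rw [setIntegral_Ioi_ite_pow, if_pos zero_le_one, zero_pow (by omega)]
    push_cast
    rw [mul_div_assoc', sub_zero, mul_one]
    congr 1
    ring
  have hL : ∀ x : Fin n → ℝ,
      q x * (∫ r in Set.Ioi (0 : ℝ), if ∑ i, x i ^ 2 ≤ r ^ 2 then w r else 0) =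
      (sqBall n 1).indicator (fun x => q x - q x * (∑ i, x i ^ 2) ^ (j + 1)) x := by
    intro x
    have hx : 0 ≤ ∑ i, x i ^ 2 := Finset.sum_nonneg fun i _ => sq_nonneg _
    rw [setIntegral_ite_le_sq]
    simp only [hw]
    rw [setIntegral_Ioi_ite_pow, show 2 * j + 1 + 1 = 2 * (j + 1) by ring, pow_mul,
      Real.sq_sqrt hx]
    have h1 : √(∑ i, x i ^ 2) ≤ 1 ↔ x ∈ sqBall n 1 := by
      rw [Real.sqrt_le_left zero_le_one, one_pow]
      rfl
    by_cases h : x ∈ sqBall n 1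
    · rw [if_pos (h1.2 h), Set.indicator_of_mem h]
      push_cast
      field_simp
      ring
    · rw [if_neg (mt h1.1 h), Set.indicator_of_notMem h, mul_zero]
  simp only [hL] at key
  rw [integral_indicator (isClosed_sqBall n 1).measurableSet,
    integral_sub (integrableOn_sqBall hqc 1) (integrableOn_sqBall (by fun_prop) 1), hR] at key
  have hpos : (0 : ℝ) < (n : ℝ) + k + 2 * (j + 1) := by positivity
  field_simp at key
  linarith

theorem eval_smul_of_isHomogeneous {n d : ℕ} {f : MvPolynomial (Fin n) ℝ}
    (hf : f.IsHomogeneous d) (r : ℝ) (x : Fin n → ℝ) :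
    MvPolynomial.eval (r • x) f = r ^ d * MvPolynomial.eval x f := by
  rw [MvPolynomial.eval_eq', MvPolynomial.eval_eq', Finset.mul_sum]
  refine Finset.sum_congr rfl fun I hI => ?_
  simp only [Pi.smul_apply, smul_eq_mul, mul_pow, Finset.prod_mul_distrib,
    Finset.prod_pow_eq_pow_sum, sum_eq_of_mem_support hf hI]
  ring

/-- The sum of the squared coefficients of a polynomial. -/
noncomputable def coeffSqSum {n : ℕ} (f : MvPolynomial (Fin n) ℝ) : ℝ :=
  ∑ m ∈ f.support, f.coeff m ^ 2

theorem coeffd_sq_of_isHomogeneous {n d : ℕ} {f : MvPolynomial (Fin n) ℝ}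
    (hf : f.IsHomogeneous d) : coeffd d f ^ 2 = coeffSqSum f := by
  rw [coeffd, Real.sq_sqrt (Finset.sum_nonneg fun _ _ => sq_nonneg _), coeffSqSum]
  congr 1
  exact Finset.filter_true_of_mem fun I hI => sum_eq_of_mem_support hf hI

theorem coeffSqSum_eq_sum {n : ℕ} (f : MvPolynomial (Fin n) ℝ) {S : Finset (Fin n →₀ ℕ)}
    (hS : f.support ⊆ S) : coeffSqSum f = ∑ m ∈ S, f.coeff m ^ 2 := by
  refine Finset.sum_subset hS fun m _ hm => ?_
  rw [MvPolynomial.notMem_support_iff.1 hm]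
  ring

theorem coeffSqSum_add_C_mul_le {n : ℕ} (f g : MvPolynomial (Fin n) ℝ) (c : ℝ) :
    coeffSqSum (f + MvPolynomial.C c * g) ≤ 2 * coeffSqSum f + 2 * c ^ 2 * coeffSqSum g := by
  classical
  set S := (f + MvPolynomial.C c * g).support ∪ (f.support ∪ g.support) with hS
  rw [coeffSqSum_eq_sum _ (S := S) Finset.subset_union_left,
    coeffSqSum_eq_sum f (S := S) (Finset.subset_union_left.trans Finset.subset_union_right),
    coeffSqSum_eq_sum g (S := S) (Finset.subset_union_right.trans Finset.subset_union_right),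
    Finset.mul_sum, Finset.mul_sum, ← Finset.sum_add_distrib]
  refine Finset.sum_le_sum fun m _ => ?_
  rw [MvPolynomial.coeff_add, MvPolynomial.coeff_C_mul]
  nlinarith [sq_nonneg (f.coeff m - c * g.coeff m)]

/-- The polynomial `|x| ^ (2 m)`. -/
noncomputable def normSqPow (n m : ℕ) : MvPolynomial (Fin n) ℝ :=
  (∑ i, MvPolynomial.X i ^ 2) ^ m

theorem eval_normSqPow (n m : ℕ) (x : Fin n → ℝ) :
    MvPolynomial.eval x (normSqPow n m) = (∑ i, x i ^ 2) ^ m := by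
  simp [normSqPow]

theorem isHomogeneous_normSqPow (n m : ℕ) : (normSqPow n m).IsHomogeneous (2 * m) := by
  have h : (∑ i, MvPolynomial.X i ^ 2 : MvPolynomial (Fin n) ℝ).IsHomogeneous 2 :=
    MvPolynomial.IsHomogeneous.sum _ _ _ fun i _ => MvPolynomial.isHomogeneous_X_pow i 2
  exact h.pow m

theorem coeff_normSqPow_nonneg_and_le (n m : ℕ) (s : Fin n →₀ ℕ) :
    0 ≤ (normSqPow n m).coeff s ∧ (normSqPow n m).coeff s ≤ m.factorial := by
  have hexp : normSqPow n m = MvPolynomial.expand 2 ((∑ i, MvPolynomial.X i) ^ m) := by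
    simp [normSqPow]
  rw [hexp]
  by_cases hs : ∀ i, 2 ∣ s i
  · obtain ⟨t, rfl⟩ : ∃ t : Fin n →₀ ℕ, s = 2 • t :=
      ⟨s.mapRange (· / 2) (by simp), by
        ext i
        simp [Nat.mul_div_cancel' (hs i)]⟩
    rw [MvPolynomial.coeff_expand_smul 2 two_ne_zero, MvPolynomial.coeff_sum_X_pow_of_fintype]
    split_ifs with ht
    · refine ⟨Nat.cast_nonneg _, Nat.cast_le.2 ?_⟩
      refine (Nat.div_le_self _ _).trans ?_
      exact (congrArg Nat.factorial ht).le
    · simp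
  · push Not at hs
    obtain ⟨i, hi⟩ := hs
    rw [MvPolynomial.coeff_expand_of_not_dvd _ hi]
    exact ⟨le_rfl, Nat.cast_nonneg _⟩

theorem coeffSqSum_normSqPow_le (n m : ℕ) :
    coeffSqSum (normSqPow n m) ≤ m.factorial * (n : ℝ) ^ m := by
  have h1 : ∑ s ∈ (normSqPow n m).support, (normSqPow n m).coeff s = (n : ℝ) ^ m := by
    have h := eval_normSqPow n m fun _ => 1
    rw [MvPolynomial.eval_eq'] at h
    simpa using h
  rw [← h1, Finset.mul_sum, coeffSqSum]
  refine Finset.sum_le_sum fun s _ => ?_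
  obtain ⟨h2, h3⟩ := coeff_normSqPow_nonneg_and_le n m s
  rw [pow_two]
  exact mul_le_mul_of_nonneg_right h3 h2

/-- The mean of a function over the Euclidean unit ball. -/
noncomputable def ballMean (n : ℕ) (q : (Fin n → ℝ) → ℝ) : ℝ :=
  (∫ x in sqBall n 1, q x) / volume.real (sqBall n 1)

theorem volume_real_sqBall_pos (n : ℕ) : 0 < volume.real (sqBall n 1) :=
  ENNReal.toReal_pos (volume_sqBall_pos n one_pos).ne' (isCompact_sqBall n 1).measure_ne_top

/-- The mean of a homogeneous function over the isotropic ball. -/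
theorem integral_unif_isoBall {n k : ℕ} {q : (Fin n → ℝ) → ℝ}
    (hq : ∀ r : ℝ, 0 < r → ∀ x, q (r • x) = r ^ k * q x) :
    ∫ x, q x ∂(unif (isoBall n)) = √((n : ℝ) + 2) ^ k * ballMean n q := by
  have hs : (0 : ℝ) ≤ (n : ℝ) + 2 := by positivity
  have hr : 0 < √((n : ℝ) + 2) := Real.sqrt_pos.2 (by positivity)
  have hb : isoBall n = sqBall n (√((n : ℝ) + 2) ^ 2) := by
    rw [Real.sq_sqrt hs]
    rfl
  have h1 := setIntegral_sqBall_of_homogeneous hq hr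
  have h2 := setIntegral_sqBall_of_homogeneous (n := n) (k := 0) (q := fun _ => 1)
    (fun _ _ _ => by simp) hr
  simp only [setIntegral_const, smul_eq_mul, mul_one, add_zero] at h2
  have hv := volume_real_sqBall_pos n
  rw [unif, hb, integral_smul_measure, h1, ENNReal.toReal_inv, ← measureReal_def, h2, ballMean,
    smul_eq_mul, pow_add]
  field_simp

theorem coeffSqSum_le_ballMean_sq {n d : ℕ} {f : MvPolynomial (Fin n) ℝ}
    (hf : f.IsHomogeneous d) :
    coeffSqSum f ≤ (∏ j ∈ Finset.range d, ((n : ℝ) + 2 * (j + 1))) *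
      ballMean n (fun x => MvPolynomial.eval x f ^ 2) := by
  have h1 := sum_coeff_sq_mul_le_integral_exp hf
  have hfc : Continuous fun x => MvPolynomial.eval x f := MvPolynomial.continuous_eval f
  rw [integral_mul_exp_of_homogeneous (k := 2 * d) (by fun_prop) (fun r _ x => by
    rw [eval_smul_of_isHomogeneous hf]; ring), radialMoment_add_two_mul] at h1
  have h2 := integral_mul_exp_of_homogeneous (n := n) (k := 0) (q := fun _ => 1)
    continuous_const (fun _ _ _ => by simp)
  simp only [one_mul, integral_exp_neg_normSq, setIntegral_const, smul_eq_mul, mul_one,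
    add_zero] at h2
  rw [h2] at h1
  have hv := volume_real_sqBall_pos n
  have hm := radialMoment_pos n
  rw [ballMean, mul_div_assoc', le_div_iff₀ hv]
  refine le_of_mul_le_mul_left ?_ hm
  rw [coeffSqSum]
  linarith

theorem ballMean_mul_normSq_pow {n k : ℕ} {q : (Fin n → ℝ) → ℝ} (hqc : Continuous q)
    (hq : ∀ r : ℝ, 0 < r → ∀ x, q (r • x) = r ^ k * q x) {m : ℕ} (hm : m ≠ 0) :
    ballMean n (fun x => q x * (∑ i, x i ^ 2) ^ m) =
      ((n : ℝ) + k) / ((n : ℝ) + k + 2 * m) * ballMean n q := by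
  obtain ⟨j, rfl⟩ := Nat.exists_eq_succ_of_ne_zero hm
  have h := setIntegral_sqBall_mul_normSq_pow hqc hq j
  have hv := volume_real_sqBall_pos n
  have hp : (0 : ℝ) < (n : ℝ) + k + 2 * (j + 1) := by positivity
  rw [ballMean, ballMean]
  push_cast
  field_simp
  linarith

theorem ballMean_add {n : ℕ} {p q : (Fin n → ℝ) → ℝ} (hp : Continuous p) (hq : Continuous q) :
    ballMean n (fun x => p x + q x) = ballMean n p + ballMean n q := by
  rw [ballMean, integral_add (integrableOn_sqBall hp 1) (integrableOn_sqBall hq 1), add_div]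
  rfl

theorem ballMean_const_mul (n : ℕ) (c : ℝ) (q : (Fin n → ℝ) → ℝ) :
    ballMean n (fun x => c * q x) = c * ballMean n q := by
  rw [ballMean, integral_const_mul, mul_div_assoc]
  rfl

theorem ballMean_one (n : ℕ) : ballMean n (fun _ => 1) = 1 := by
  simp [ballMean, (volume_real_sqBall_pos n).ne']

theorem ballMean_nonneg {n : ℕ} {q : (Fin n → ℝ) → ℝ} (hq : ∀ x, 0 ≤ q x) : 0 ≤ ballMean n q :=
  div_nonneg (integral_nonneg hq) measureReal_nonneg

theorem ballMean_eq_zero_of_odd {n : ℕ} {q : (Fin n → ℝ) → ℝ} (hq : ∀ x, q (-x) = -q x) :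
    ballMean n q = 0 := by
  have h1 : ∫ x in sqBall n 1, q x = ∫ x, (sqBall n 1).indicator q x :=
    (integral_indicator (isClosed_sqBall n 1).measurableSet).symm
  have h2 : ∫ x, (sqBall n 1).indicator q (-x) = ∫ x, -(sqBall n 1).indicator q x := by
    congr 1
    ext x
    have : -x ∈ sqBall n 1 ↔ x ∈ sqBall n 1 := by simp [sqBall]
    by_cases h : x ∈ sqBall n 1
    · rw [Set.indicator_of_mem (this.2 h), Set.indicator_of_mem h, hq]
    · rw [Set.indicator_of_notMem (mt this.1 h), Set.indicator_of_notMem h, neg_zero]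
  rw [integral_neg_eq_self, integral_neg] at h2
  rw [ballMean, h1, show ∫ x, (sqBall n 1).indicator q x = 0 by linarith, zero_div]

theorem two_mul_prod_le (n : ℕ) {d : ℕ} (hd : 1 ≤ d) :
    2 * ∏ j ∈ Finset.range d, ((n : ℝ) + 2 * (j + 1)) ≤
      (d + 1).factorial * ((n : ℝ) + 2) ^ d := by
  induction d, hd using Nat.le_induction with
  | base => simp [Nat.factorial]
  | succ d _ ih =>
    rw [Finset.prod_range_succ, Nat.factorial_succ (d + 1), pow_succ, ← mul_assoc]
    push_cast
    have h : (n : ℝ) + 2 * (d + 1) ≤ ((d : ℝ) + 1 + 1) * (n + 2) := by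
      nlinarith [mul_nonneg d.cast_nonneg (n.cast_nonneg (α := ℝ)), n.cast_nonneg (α := ℝ)]
    calc _ ≤ (((d + 1).factorial : ℝ) * ((n : ℝ) + 2) ^ d) * (((d : ℝ) + 1 + 1) * (n + 2)) :=
          mul_le_mul ih h (by positivity) (by positivity)
      _ = _ := by ring

theorem two_mul_factorial_mul_pow_le {n m : ℕ} (hn : 1 ≤ n) (hm : 2 ≤ m) :
    2 * (m.factorial * (n : ℝ) ^ m) ≤ (2 * m + 1).factorial * ((n : ℝ) + 2) ^ (2 * m) *
      ((n : ℝ) / (n + 4 * m) - ((n : ℝ) / (n + 2 * m)) ^ 2) := by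
  have hn' : (1 : ℝ) ≤ n := by exact_mod_cast hn
  have hm' : (2 : ℝ) ≤ m := by exact_mod_cast hm
  have h0 : (n : ℝ) / (n + 4 * m) - ((n : ℝ) / (n + 2 * m)) ^ 2 =
      n * (4 * (m : ℝ) ^ 2) / ((n + 4 * m) * (n + 2 * m) ^ 2) := by
    field_simp
    ring
  rw [h0, mul_div_assoc', le_div_iff₀ (by positivity)]
  have h1 : ((n : ℝ) + 4 * m) ≤ 2 * m * (n + 2) := by nlinarith
  have h2 : ((n : ℝ) + 2 * m) ≤ m * (n + 2) := by nlinarith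
  have h3 : ((n : ℝ) + 4 * m) * (n + 2 * m) ^ 2 ≤ 2 * m * (n + 2) * (m * (n + 2)) ^ 2 :=
    mul_le_mul h1 (pow_le_pow_left₀ (by positivity) h2 2) (by positivity) (by positivity)
  have h4 : (n : ℝ) ^ (m - 1) * (n + 2) ^ 3 ≤ ((n : ℝ) + 2) ^ (2 * m) := by
    calc (n : ℝ) ^ (m - 1) * (n + 2) ^ 3 ≤ ((n : ℝ) + 2) ^ (m - 1) * (n + 2) ^ 3 := by
          gcongr
          linarith
      _ = ((n : ℝ) + 2) ^ (m - 1 + 3) := by rw [pow_add]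
      _ ≤ ((n : ℝ) + 2) ^ (2 * m) := pow_le_pow_right₀ (by linarith) (by omega)
  have h5 : (m : ℝ) * m.factorial ≤ (2 * m + 1).factorial := by
    have : m * m.factorial ≤ (2 * m + 1).factorial :=
      calc m * m.factorial ≤ (m + 1) * m.factorial := Nat.mul_le_mul_right _ (Nat.le_succ m)
        _ = (m + 1).factorial := (Nat.factorial_succ m).symm
        _ ≤ (2 * m + 1).factorial := Nat.factorial_le (by omega)
    exact_mod_cast this
  have h6 : (n : ℝ) ^ m = n * (n : ℝ) ^ (m - 1) := by
    rw [← pow_succ', Nat.sub_add_cancel (by omega)]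
  calc 2 * (m.factorial * (n : ℝ) ^ m) * ((n + 4 * m) * (n + 2 * m) ^ 2)
      ≤ 2 * (m.factorial * (n : ℝ) ^ m) * (2 * m * (n + 2) * (m * (n + 2)) ^ 2) :=
        mul_le_mul_of_nonneg_left h3 (by positivity)
    _ = (4 * m ^ 2 * n) * ((m * m.factorial) * ((n : ℝ) ^ (m - 1) * (n + 2) ^ 3)) := by
        rw [h6]
        ring
    _ ≤ (4 * m ^ 2 * n) * ((2 * m + 1).factorial * ((n : ℝ) + 2) ^ (2 * m)) := by gcongr
    _ = _ := by ring

/-- The variance bound on the unit ball. -/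
theorem coeffSqSum_le_variance_ballMean {d n : ℕ} (hd : 3 ≤ d) (hn : 1 ≤ n)
    {f : MvPolynomial (Fin n) ℝ} (hf : f.IsHomogeneous d) :
    coeffSqSum f ≤ (d + 1).factorial * ((n : ℝ) + 2) ^ d *
      (ballMean n (fun x => MvPolynomial.eval x f ^ 2) -
        ballMean n (fun x => MvPolynomial.eval x f) ^ 2) := by
  have hA := two_mul_prod_le n (d := d) (by omega)
  have hsq : ∀ g : MvPolynomial (Fin n) ℝ,
      0 ≤ ballMean n (fun x => MvPolynomial.eval x g ^ 2) :=
    fun g => ballMean_nonneg fun x => sq_nonneg _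
  have hB : ∀ g : MvPolynomial (Fin n) ℝ, g.IsHomogeneous d → 2 * coeffSqSum g ≤
      (d + 1).factorial * ((n : ℝ) + 2) ^ d *
        ballMean n (fun x => MvPolynomial.eval x g ^ 2) := fun g hg => by
    have h1 := coeffSqSum_le_ballMean_sq hg
    have h2 := mul_le_mul_of_nonneg_right hA (hsq g)
    linarith
  have hN : ∀ g : MvPolynomial (Fin n) ℝ, 0 ≤ coeffSqSum g :=
    fun g => Finset.sum_nonneg fun _ _ => sq_nonneg _
  obtain ⟨m, hm⟩ | hodd := Nat.even_or_odd d
  · obtain rfl : d = 2 * m := by omega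
    have hm2 : 2 ≤ m := by omega
    have hm0 : m ≠ 0 := by omega
    have hn' : (0 : ℝ) < n := by exact_mod_cast hn
    set c : ℝ := ballMean n (fun x => MvPolynomial.eval x f) / (n / (n + 2 * m)) with hc
    have hmean : ballMean n (fun x => MvPolynomial.eval x f) = c * (n / (n + 2 * m)) := by
      rw [hc, div_mul_cancel₀]
      positivity
    set g := f + MvPolynomial.C (-c) * normSqPow n m with hg
    have hgh : g.IsHomogeneous (2 * m) := by
      refine hf.add ?_
      have h := (MvPolynomial.isHomogeneous_C (Fin n) (-c)).mul (isHomogeneous_normSqPow n m)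
      rwa [zero_add] at h
    have hfg : f = g + MvPolynomial.C c * normSqPow n m := by
      rw [hg, map_neg]
      ring
    have hgc : Continuous fun x => MvPolynomial.eval x g := MvPolynomial.continuous_eval g
    have hfe : ∀ x, MvPolynomial.eval x f =
        MvPolynomial.eval x g + c * (1 * (∑ i, x i ^ 2) ^ m) := fun x => by
      rw [hfg]
      simp [eval_normSqPow]
    have hρ : ∀ j : ℕ, j ≠ 0 → ballMean n (fun x => 1 * (∑ i, x i ^ 2) ^ j) =
        n / (n + 2 * j) := fun j hj => by
      rw [ballMean_mul_normSq_pow (k := 0) continuous_const (fun _ _ _ => by simp) hj,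
        ballMean_one]
      simp
    have hg0 : ballMean n (fun x => MvPolynomial.eval x g) = 0 := by
      have h := hmean
      simp only [hfe] at h
      rw [ballMean_add hgc (by fun_prop), ballMean_const_mul, hρ m hm0] at h
      linarith
    have hgρ : ballMean n (fun x => MvPolynomial.eval x g * (∑ i, x i ^ 2) ^ m) = 0 := by
      rw [ballMean_mul_normSq_pow hgc (fun r _ x => eval_smul_of_isHomogeneous hgh r x) hm0,
        hg0, mul_zero]
    have hf2 : ballMean n (fun x => MvPolynomial.eval x f ^ 2) =
        ballMean n (fun x => MvPolynomial.eval x g ^ 2) + c ^ 2 * (n / (n + 4 * m)) := by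
      have h : (fun x => MvPolynomial.eval x f ^ 2) = fun x => MvPolynomial.eval x g ^ 2 +
          (2 * c * (MvPolynomial.eval x g * (∑ i, x i ^ 2) ^ m) +
            c ^ 2 * (1 * (∑ i, x i ^ 2) ^ (2 * m))) := by
        ext x
        rw [hfe]
        ring
      rw [h, ballMean_add (by fun_prop) (by fun_prop), ballMean_add (by fun_prop) (by fun_prop),
        ballMean_const_mul, ballMean_const_mul, hgρ, hρ (2 * m) (by omega)]
      push_cast
      ring
    have h1 : coeffSqSum f ≤ 2 * coeffSqSum g + 2 * c ^ 2 * coeffSqSum (normSqPow n m) := by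
      conv_lhs => rw [hfg]
      exact coeffSqSum_add_C_mul_le g (normSqPow n m) c
    have h2 := mul_le_mul_of_nonneg_left (coeffSqSum_normSqPow_le n m) (sq_nonneg c)
    have h3 := mul_le_mul_of_nonneg_left (two_mul_factorial_mul_pow_le hn hm2) (sq_nonneg c)
    have h4 := hB g hgh
    rw [hf2, hmean]
    linarith
  · have h0 : ballMean n (fun x => MvPolynomial.eval x f) = 0 := by
      refine ballMean_eq_zero_of_odd fun x => ?_
      have h := eval_smul_of_isHomogeneous hf (-1) x
      rwa [hodd.neg_one_pow, neg_one_smul, neg_one_mul] at h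
    rw [h0]
    linarith [hB f hf, hN f]

/-- dimension-free variance lower bound for homogeneous polynomials of
degree `d ≥ 3` on the isotropic Euclidean ball. -/
theorem stmt18 (d : ℕ) (hd : 3 ≤ d) (n : ℕ) (hn : 1 ≤ n)
    (f : MvPolynomial (Fin n) ℝ) (hf : f.IsHomogeneous d) :
    (∫ x, (MvPolynomial.eval x f) ^ 2 ∂(unif (isoBall n))) -
        (∫ x, MvPolynomial.eval x f ∂(unif (isoBall n))) ^ 2 ≥
      coeffd d f ^ 2 / ((d + 1).factorial : ℝ) := by
  rw [integral_unif_isoBall (k := 2 * d) (q := fun x => MvPolynomial.eval x f ^ 2)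
      (fun r _ x => by rw [eval_smul_of_isHomogeneous hf]; ring),
    integral_unif_isoBall (fun r _ x => eval_smul_of_isHomogeneous hf r x),
    coeffd_sq_of_isHomogeneous hf, pow_mul, Real.sq_sqrt (by positivity), mul_pow, ← pow_mul,
    mul_comm d 2, pow_mul, Real.sq_sqrt (by positivity), ← mul_sub, ge_iff_le,
    div_le_iff₀ (by positivity)]
  linarith [coeffSqSum_le_variance_ballMean hd hn hf]
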